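/- arXiv:1509.07003 — 2 statements merged into one kernel-verified Lean document; each statement's English description precedes it below -/
import Mathlib

section
/- Let μ > 0, γ ≥ 0, δ₀ ∈ ℝ, and define Q₂(G) = 2μ·(|sym G|² + γ·(tr G)²) for G ∈ ℝ^{2×2}. Define B̌_SB(t) = −δ₀·( diag(cos²(π/4 + πt/2), 0) − I₂/3 ), and for G ∈ ℝ^{2×2} set Q̄_SB(G) = inf over D ∈ ℝ^{2×2} of ∫_{−1/2}^{1/2} Q₂(D + t·G + B̌_SB(t)) dt. Let Ā_SB = (12δ₀/π²)·diag(−1, 0) and β_SB = 2μ·(1+γ)·δ₀²·(1/8 − 12/π⁴). Then for every symmetric G ∈ ℝ^{2×2}, Q̄_SB(G) = (1/12)·Q₂(G − Ā_SB) + β_SB; in particular Q̄_SB(G) − (1/12)·Q₂(G − Ā_SB) is a constant independent of G, and this constant is strictly positive when δ₀ ≠ 0. -/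
open Matrix Real MeasureTheory

/-- Frobenius norm squared of a real square matrix. -/
noncomputable def frobSq {ι : Type*} [Fintype ι] (M : Matrix ι ι ℝ) : ℝ :=
  ∑ i, ∑ j, (M i j) ^ 2

/-- Symmetric part of a square matrix. -/
noncomputable def symPart {ι : Type*} [Fintype ι] (M : Matrix ι ι ℝ) : Matrix ι ι ℝ :=
  (1 / 2 : ℝ) • (M + Mᵀ)

/-- The 2D quadratic form `Q₂(G) = 2μ (|sym G|² + γ (tr G)²)`. -/
noncomputable def Q₂ (μ γ : ℝ) (G : Matrix (Fin 2) (Fin 2) ℝ) : ℝ :=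
  2 * μ * (frobSq (symPart G) + γ * (G.trace) ^ 2)

/-- The splay-bend matrix `B̌_SB(t) = −δ₀ (diag(cos²(π/4+πt/2), 0) − I₂/3)`. -/
noncomputable def BSB (δ₀ t : ℝ) : Matrix (Fin 2) (Fin 2) ℝ :=
  (-δ₀) • (Matrix.diagonal ![Real.cos (π / 4 + π * t / 2) ^ 2, 0]
    - (1 / 3 : ℝ) • (1 : Matrix (Fin 2) (Fin 2) ℝ))

/-- `Q̄_SB(G) = inf_D ∫_{−1/2}^{1/2} Q₂(D + t G + B̌_SB(t)) dt`. -/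
noncomputable def QbarSB (μ γ δ₀ : ℝ) (G : Matrix (Fin 2) (Fin 2) ℝ) : ℝ :=
  sInf {x : ℝ | ∃ D : Matrix (Fin 2) (Fin 2) ℝ,
    x = ∫ t in Set.Ioo (-(1 : ℝ)/2) (1/2), Q₂ μ γ (D + t • G + BSB δ₀ t)}

/-- The splay-bend target curvature `Ā_SB = (12δ₀/π²) diag(−1,0)`. -/
noncomputable def ASB (δ₀ : ℝ) : Matrix (Fin 2) (Fin 2) ℝ :=
  (12 * δ₀ / π ^ 2) • Matrix.diagonal ![-1, 0]

/-- The constant `β_SB = 2μ (1+γ) δ₀² (1/8 − 12/π⁴)`. -/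
noncomputable def βSB (μ γ δ₀ : ℝ) : ℝ :=
  2 * μ * (1 + γ) * δ₀ ^ 2 * (1 / 8 - 12 / π ^ 4)

/-- Moments of `1, t, sin (π t)` and their products over `(-1/2, 1/2)`. -/
lemma integral_quadratic_id_sin (a b c d e f : ℝ) :
    ∫ t in Set.Ioo (-(1 : ℝ)/2) (1/2), (a + b * t + c * sin (π * t) + d * t ^ 2
      + e * (t * sin (π * t)) + f * sin (π * t) ^ 2) = a + d / 12 + 2 * e / π ^ 2 + f / 2 := by
  have hπ : π ≠ 0 := pi_ne_zero
  rw [← integral_Ioc_eq_integral_Ioo, ← intervalIntegral.integral_of_le (by norm_num)]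
  have hderiv (t : ℝ) : HasDerivAt (fun t => a * t + b * (t ^ 2 / 2) - c * (cos (π * t) / π)
      + d * (t ^ 3 / 3) + e * (sin (π * t) / π ^ 2 - t * cos (π * t) / π)
      + f * (t / 2 - sin (π * t) * cos (π * t) / (2 * π)))
      (a + b * t + c * sin (π * t) + d * t ^ 2
      + e * (t * sin (π * t)) + f * sin (π * t) ^ 2) t := by
    have hlin : HasDerivAt (fun t : ℝ => π * t) π t := by
      simpa using (hasDerivAt_id t).const_mul π
    have hid := hasDerivAt_id' t
    have hsin := hlin.sin
    have hcos := hlin.cos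
    refine HasDerivAt.congr_deriv ((((((hid.const_mul a).add (((hid.pow 2).div_const 2).const_mul b)).sub
      ((hcos.div_const π).const_mul c)).add (((hid.pow 3).div_const 3).const_mul d)).add
      (((hsin.div_const (π ^ 2)).sub ((hid.mul hcos).div_const π)).const_mul e)).add
      (((hid.div_const 2).sub ((hsin.mul hcos).div_const (2 * π))).const_mul f)) ?_
    field_simp
    linear_combination (-3 * f * π) * sin_sq_add_cos_sq (π * t)
  rw [intervalIntegral.integral_eq_sub_of_hasDerivAt (fun t _ => hderiv t)
    (by apply Continuous.intervalIntegrable; fun_prop)]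
  have h₁ : π * (1 / 2) = π / 2 := by ring
  have h₂ : π * (-1 / 2) = -(π / 2) := by ring
  simp only [h₁, h₂, sin_neg, cos_neg, sin_pi_div_two, cos_pi_div_two]
  field_simp
  ring

lemma Q₂_eq (μ γ : ℝ) (G : Matrix (Fin 2) (Fin 2) ℝ) :
    Q₂ μ γ G = 2 * μ * (G 0 0 ^ 2 + G 1 1 ^ 2 + (G 0 1 + G 1 0) ^ 2 / 2
      + γ * (G 0 0 + G 1 1) ^ 2) := by
  simp [Q₂, frobSq, symPart, Fin.sum_univ_two, Matrix.trace, -mul_eq_mul_left_iff]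
  ring

lemma Q₂_nonneg {μ γ : ℝ} (hμ : 0 ≤ μ) (hγ : 0 ≤ γ) (G : Matrix (Fin 2) (Fin 2) ℝ) :
    0 ≤ Q₂ μ γ G := by
  rw [Q₂_eq]
  positivity

lemma cos_sq_pi_div_four_add (t : ℝ) :
    cos (π / 4 + π * t / 2) ^ 2 = 1 / 2 - sin (π * t) / 2 := by
  rw [cos_sq, show 2 * (π / 4 + π * t / 2) = π * t + π / 2 by ring, cos_add_pi_div_two]
  ring

/-- The thickness average of `BSB`. -/
noncomputable def meanBSB (δ₀ : ℝ) : Matrix (Fin 2) (Fin 2) ℝ :=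
  Matrix.diagonal ![-δ₀ / 6, δ₀ / 3]

lemma BSB_eq (δ₀ t : ℝ) :
    BSB δ₀ t = meanBSB δ₀ + Matrix.diagonal ![δ₀ / 2 * sin (π * t), 0] := by
  ext i j
  fin_cases i <;> fin_cases j <;> simp [BSB, meanBSB, cos_sq_pi_div_four_add] <;> ring

/-- The energy splits into a square in the mean strain and a part independent of it. -/
lemma integral_Q₂_add_BSB (μ γ δ₀ : ℝ) (D G : Matrix (Fin 2) (Fin 2) ℝ) :
    ∫ t in Set.Ioo (-(1 : ℝ)/2) (1/2), Q₂ μ γ (D + t • G + BSB δ₀ t)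
      = Q₂ μ γ (D + meanBSB δ₀) + ((1 / 12) * Q₂ μ γ (G - ASB δ₀) + βSB μ γ δ₀) := by
  obtain ⟨E, rfl⟩ : ∃ E, D = E - meanBSB δ₀ := ⟨D + meanBSB δ₀, by abel⟩
  have hpi : π ≠ 0 := pi_ne_zero
  calc
    _ = ∫ t in Set.Ioo (-(1 : ℝ)/2) (1/2), (Q₂ μ γ E
        + 4 * μ * (E 0 0 * G 0 0 + E 1 1 * G 1 1 + (E 0 1 + E 1 0) * (G 0 1 + G 1 0) / 2
          + γ * (E 0 0 + E 1 1) * (G 0 0 + G 1 1)) * t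
        + 2 * μ * δ₀ * (E 0 0 + γ * (E 0 0 + E 1 1)) * sin (π * t)
        + Q₂ μ γ G * t ^ 2
        + 2 * μ * δ₀ * (G 0 0 + γ * (G 0 0 + G 1 1)) * (t * sin (π * t))
        + μ * (1 + γ) * δ₀ ^ 2 / 2 * sin (π * t) ^ 2) := by
      congr 1 with t
      simp only [BSB_eq, Q₂_eq, Matrix.add_apply, Matrix.sub_apply, Matrix.smul_apply, smul_eq_mul,
        Matrix.diagonal_apply]
      simp
      ring
    _ = _ := by
      rw [integral_quadratic_id_sin]
      simp [Q₂_eq, ASB, βSB]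
      field_simp
      ring

/-- for every symmetric `G`, `Q̄_SB(G) = (1/12) Q₂(G − Ā_SB) + β_SB`;
the constant `β_SB` is independent of `G` and strictly positive when `δ₀ ≠ 0`. -/
theorem stmt6 (μ γ δ₀ : ℝ) (hμ : 0 < μ) (hγ : 0 ≤ γ) :
    (∀ G : Matrix (Fin 2) (Fin 2) ℝ, G.IsSymm →
      QbarSB μ γ δ₀ G = (1 / 12) * Q₂ μ γ (G - ASB δ₀) + βSB μ γ δ₀) ∧
    (δ₀ ≠ 0 → 0 < βSB μ γ δ₀) := by
  refine ⟨fun G _ => IsLeast.csInf_eq ⟨⟨-meanBSB δ₀, ?_⟩, ?_⟩, fun hδ => ?_⟩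
  · rw [integral_Q₂_add_BSB]
    simp [Q₂_eq]
  · rintro x ⟨D, rfl⟩
    rw [integral_Q₂_add_BSB]
    linarith [Q₂_nonneg hμ.le hγ (D + meanBSB δ₀)]
  · have h2 : (9.8 : ℝ) < π ^ 2 := by nlinarith [pi_gt_d2]
    have h4 : 96 < π ^ 4 := by nlinarith
    have : 0 < 1 / 8 - 12 / π ^ 4 := by
      rw [sub_pos, div_lt_div_iff₀ (by positivity) (by norm_num)]
      linarith
    unfold βSB
    positivity
end

section
/- Let ω ⊆ ℝ² be a nonempty bounded open convex set, h > 0, and Ω_h = ω × (−h/2, h/2) ⊆ ℝ³. Let A = diag(A₁, A₂, A₃) and B = diag(B₁, B₂, B₃) be diagonal 3×3 real matrices, and suppose that G(t) = I₃ + t·A + t²·B is positive definite for every t ∈ (−h/2, h/2). Then there exists a smooth (C^∞) map v : Ω_h → ℝ³ with det Dv(z) > 0 and (Dv(z))ᵀ·Dv(z) = G(z₃) for every z = (z₁,z₂,z₃) ∈ Ω_h if and only if one of the following four conditions holds: (i) A = 0 and B = 0; (ii) A₂ = A₃ = 0, B₂ = B₃ = 0, and B₁ = A₁²/4 ≠ 0;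 (iii) A₁ = A₃ = 0, B₁ = B₃ = 0, and B₂ = A₂²/4 ≠ 0; (iv) A₁ = A₂ = 0, B₁ = B₂ = 0, and A₃² + B₃² ≠ 0. -/
open Matrix Real

/-- The Jacobian matrix of a map `v : ℝ³ → ℝ³` at a point. -/
noncomputable def Dmat (v : (Fin 3 → ℝ) → (Fin 3 → ℝ)) (z : Fin 3 → ℝ) :
    Matrix (Fin 3) (Fin 3) ℝ :=
  Matrix.of fun i j => fderiv ℝ v z (Pi.single j 1) i

/-- The slab `Ω_h = ω × (−h/2, h/2)` inside `ℝ³`. -/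
def slab (ω : Set (ℝ × ℝ)) (h : ℝ) : Set (Fin 3 → ℝ) :=
  {z | (z 0, z 1) ∈ ω ∧ z 2 ∈ Set.Ioo (-(h / 2)) (h / 2)}

/-- The quadratic-in-thickness strain `G(t) = I₃ + t A + t² B` with diagonal `A`, `B`. -/
noncomputable def Gquad (A B : Fin 3 → ℝ) (t : ℝ) : Matrix (Fin 3) (Fin 3) ℝ :=
  1 + t • Matrix.diagonal A + (t ^ 2) • Matrix.diagonal B

/-- The `j`-th partial derivative of a map on `ℝ³`. -/
noncomputable def partialDeriv {F : Type*} [NormedAddCommGroup F] [NormedSpace ℝ F] (j : Fin 3)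
    (f : (Fin 3 → ℝ) → F) (z : Fin 3 → ℝ) : F :=
  fderiv ℝ f z (Pi.single j 1)

section PartialDeriv

variable {F : Type*} [NormedAddCommGroup F] [NormedSpace ℝ F] {S : Set (Fin 3 → ℝ)}
  {f g : (Fin 3 → ℝ) → F} {z : Fin 3 → ℝ}

theorem partialDeriv_congr (hS : IsOpen S) (hfg : ∀ z ∈ S, f z = g z) (hz : z ∈ S) (j : Fin 3) :
    partialDeriv j f z = partialDeriv j g z := by
  have : f =ᶠ[nhds z] g := Filter.eventually_of_mem (hS.mem_nhds hz) hfg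
  rw [partialDeriv, partialDeriv, this.fderiv_eq]

theorem contDiffOn_partialDeriv (hS : IsOpen S) (hf : ContDiffOn ℝ (⊤ : ℕ∞) f S) (j : Fin 3) :
    ContDiffOn ℝ (⊤ : ℕ∞) (partialDeriv j f) S :=
  (hf.fderiv_of_isOpen hS (m := (⊤ : ℕ∞)) (by simp)).clm_apply contDiffOn_const

theorem differentiableAt_of_contDiffOn_top (hS : IsOpen S) (hf : ContDiffOn ℝ (⊤ : ℕ∞) f S)
    (hz : z ∈ S) : DifferentiableAt ℝ f z :=
  (hf.contDiffAt (hS.mem_nhds hz)).differentiableAt (by simp)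

theorem partialDeriv_comm (hS : IsOpen S) (hf : ContDiffOn ℝ (⊤ : ℕ∞) f S) (hz : z ∈ S)
    (i j : Fin 3) :
    partialDeriv i (partialDeriv j f) z = partialDeriv j (partialDeriv i f) z := by
  have hd : DifferentiableAt ℝ (fderiv ℝ f) z :=
    differentiableAt_of_contDiffOn_top hS
      (hf.fderiv_of_isOpen hS (m := (⊤ : ℕ∞)) (by simp)) hz
  have key (i j : Fin 3) : partialDeriv i (partialDeriv j f) z =
      fderiv ℝ (fderiv ℝ f) z (Pi.single i 1) (Pi.single j 1) := by
    have := (hd.hasFDerivAt.clm_apply (hasFDerivAt_const (Pi.single j (1 : ℝ)) z)).fderiv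
    unfold partialDeriv
    rw [this]
    simp
  rw [key, key]
  exact ((hf.contDiffAt (hS.mem_nhds hz)).isSymmSndFDerivAt
    (by simpa using WithTop.coe_le_coe.2 (le_top (a := (2 : ℕ∞))))).eq _ _

theorem partialDeriv_dotProduct {f g : (Fin 3 → ℝ) → Fin 3 → ℝ} (hf : DifferentiableAt ℝ f z)
    (hg : DifferentiableAt ℝ g z) (j : Fin 3) :
    partialDeriv j (fun z => f z ⬝ᵥ g z) z =
      partialDeriv j f z ⬝ᵥ g z + f z ⬝ᵥ partialDeriv j g z := by
  have h := HasFDerivAt.fun_sum (u := Finset.univ) fun i _ =>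
    (hasFDerivAt_pi'.1 hf.hasFDerivAt i).fun_mul (hasFDerivAt_pi'.1 hg.hasFDerivAt i)
  unfold partialDeriv dotProduct
  rw [h.fderiv, ← Finset.sum_add_distrib]
  simp only [_root_.sum_apply]
  refine Finset.sum_congr rfl fun i _ => ?_
  simp
  ring

theorem partialDeriv_comp_two {φ : ℝ → ℝ} {φ' : ℝ} (hφ : HasDerivAt φ φ' (z 2)) (j : Fin 3) :
    partialDeriv j (fun z => φ (z 2)) z = if j = 2 then φ' else 0 := by
  have h := hφ.comp_hasFDerivAt z (hasFDerivAt_apply (𝕜 := ℝ) (2 : Fin 3) z)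
  have h' : fderiv ℝ (fun z : Fin 3 → ℝ => φ (z 2)) z = _ := h.fderiv
  rw [partialDeriv, h']
  simp [Pi.single_apply, eq_comm]

end PartialDeriv

/-- If `EᵀE = diag d` with `d > 0`, dot products are computed from the components along the
columns of `E`. -/
theorem dotProduct_eq_sum_div {n : Type*} [Fintype n] [DecidableEq n] {E : Matrix n n ℝ}
    {d : n → ℝ} (hE : Eᵀ * E = diagonal d) (hd : ∀ k, 0 < d k) (x y : n → ℝ) :
    x ⬝ᵥ y = ∑ k, (x ⬝ᵥ E.col k) * (y ⬝ᵥ E.col k) / d k := by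
  have h1 : diagonal (fun k => (d k)⁻¹) * Eᵀ * E = 1 := by
    rw [Matrix.mul_assoc, hE, diagonal_mul_diagonal, ← diagonal_one]
    congr 1
    ext k
    exact inv_mul_cancel₀ (hd k).ne'
  have h2 := mul_eq_one_comm.1 h1
  calc x ⬝ᵥ y = x ⬝ᵥ (E * (diagonal (fun k => (d k)⁻¹) * Eᵀ)) *ᵥ y := by rw [h2, one_mulVec]
    _ = (x ᵥ* E) ⬝ᵥ (diagonal (fun k => (d k)⁻¹) *ᵥ (Eᵀ *ᵥ y)) := by
      rw [← mulVec_mulVec, ← mulVec_mulVec, dotProduct_mulVec]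
    _ = _ := by
      rw [mulVec_transpose]
      refine Finset.sum_congr rfl fun k _ => ?_
      rw [mulVec_diagonal]
      simp only [vecMul]
      change (x ⬝ᵥ E.col k) * ((d k)⁻¹ * (y ⬝ᵥ E.col k)) = _
      ring

section Metric

variable {S : Set (Fin 3 → ℝ)} {v : (Fin 3 → ℝ) → Fin 3 → ℝ} {g g' g'' : Fin 3 → ℝ → ℝ}
  {z : Fin 3 → ℝ}

/-- Christoffel symbols of the first kind of the metric `diag g(z₃)`. -/
theorem partialDeriv_partialDeriv_dotProduct (hS : IsOpen S) (hv : ContDiffOn ℝ (⊤ : ℕ∞) v S)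
    (hmet : ∀ z ∈ S, ∀ i j, partialDeriv i v z ⬝ᵥ partialDeriv j v z =
      if i = j then g i (z 2) else 0)
    (hg : ∀ i, ∀ z ∈ S, HasDerivAt (g i) (g' i (z 2)) (z 2)) (hz : z ∈ S) (i j k : Fin 3) :
    partialDeriv i (partialDeriv j v) z ⬝ᵥ partialDeriv k v z =
      ((if j = k ∧ i = 2 then g' j (z 2) else 0) + (if i = k ∧ j = 2 then g' i (z 2) else 0) -
        (if i = j ∧ k = 2 then g' i (z 2) else 0)) / 2 := by
  have key (k i j : Fin 3) : partialDeriv k (partialDeriv i v) z ⬝ᵥ partialDeriv j v z +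
      partialDeriv i v z ⬝ᵥ partialDeriv k (partialDeriv j v) z =
      if i = j ∧ k = 2 then g' i (z 2) else 0 := by
    have hd (i : Fin 3) : DifferentiableAt ℝ (partialDeriv i v) z :=
      differentiableAt_of_contDiffOn_top hS (contDiffOn_partialDeriv hS hv i) hz
    rw [← partialDeriv_dotProduct (hd i) (hd j),
      partialDeriv_congr hS (fun z hz => hmet z hz i j) hz]
    by_cases hij : i = j
    · simpa [hij] using partialDeriv_comp_two (hg j z hz) k
    · simp [hij, partialDeriv]
  have h1 := key i j k
  have h2 := key j i k
  have h3 := key k i j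
  rw [partialDeriv_comm hS hv hz k i, partialDeriv_comm hS hv hz k j] at h3
  rw [partialDeriv_comm hS hv hz j i] at h2
  rw [dotProduct_comm (partialDeriv j v z)] at h1
  rw [dotProduct_comm (partialDeriv i v z)] at h2 h3
  linarith

/-- The symmetry of third derivatives, tested against a first derivative. -/
theorem partialDeriv_dotProduct_sub (hS : IsOpen S) (hv : ContDiffOn ℝ (⊤ : ℕ∞) v S)
    (hz : z ∈ S) (i j k l : Fin 3) :
    partialDeriv l (fun z => partialDeriv i (partialDeriv j v) z ⬝ᵥ partialDeriv k v z) z -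
      partialDeriv i (fun z => partialDeriv l (partialDeriv j v) z ⬝ᵥ partialDeriv k v z) z =
    partialDeriv i (partialDeriv j v) z ⬝ᵥ partialDeriv l (partialDeriv k v) z -
      partialDeriv l (partialDeriv j v) z ⬝ᵥ partialDeriv i (partialDeriv k v) z := by
  have hc (i : Fin 3) := contDiffOn_partialDeriv hS hv i
  have hd (i : Fin 3) := differentiableAt_of_contDiffOn_top hS (hc i) hz
  have hd2 (i j : Fin 3) :=
    differentiableAt_of_contDiffOn_top hS (contDiffOn_partialDeriv hS (hc j) i) hz
  rw [partialDeriv_dotProduct (hd2 i j) (hd k), partialDeriv_dotProduct (hd2 l j) (hd k),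
    partialDeriv_comm hS (hc j) hz l i]
  ring

/-- Vanishing of the curvature of the metric `diag g(z₃)`. -/
theorem curvature_eq_zero (hS : IsOpen S) (hv : ContDiffOn ℝ (⊤ : ℕ∞) v S)
    (hmet : ∀ z ∈ S, ∀ i j, partialDeriv i v z ⬝ᵥ partialDeriv j v z =
      if i = j then g i (z 2) else 0)
    (hg : ∀ i, ∀ z ∈ S, HasDerivAt (g i) (g' i (z 2)) (z 2))
    (hg' : ∀ i, ∀ z ∈ S, HasDerivAt (g' i) (g'' i (z 2)) (z 2))
    (hpos : ∀ i, ∀ z ∈ S, 0 < g i (z 2)) (hz : z ∈ S) :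
    g' 0 (z 2) * g' 1 (z 2) = 0 ∧
    ∀ i : Fin 3, i ≠ 2 → 2 * g'' i (z 2) * g i (z 2) * g 2 (z 2) =
      g' i (z 2) * g' 2 (z 2) * g i (z 2) + g' i (z 2) ^ 2 * g 2 (z 2) := by
  have hE : (Dmat v z)ᵀ * Dmat v z = diagonal fun i => g i (z 2) := by
    ext i j
    rw [diagonal_apply]
    exact hmet z hz i j
  have hdot := dotProduct_eq_sum_div hE (fun k => hpos k z hz)
  have hcol (k : Fin 3) : (Dmat v z).col k = partialDeriv k v z := rfl
  have hΓ {z} (hz : z ∈ S) := partialDeriv_partialDeriv_dotProduct hS hv hmet hg hz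
  have hR := partialDeriv_dotProduct_sub hS hv hz
  have hdΓ (l i j k : Fin 3) := partialDeriv_congr hS (fun z hz => hΓ hz i j k) hz l
  simp only [hdot (partialDeriv _ (partialDeriv _ v) z) (partialDeriv _ (partialDeriv _ v) z),
    hcol, hΓ hz, hdΓ, Fin.sum_univ_three] at hR
  have hp := fun i => hpos i z hz
  have h0 := hp 0
  have h1 := hp 1
  have h2 := hp 2
  have hc (i j : Fin 3) : partialDeriv j (fun z : Fin 3 → ℝ => -g' i (z 2) / 2) z =
      if j = 2 then -g'' i (z 2) / 2 else 0 :=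
    partialDeriv_comp_two (φ := fun t => -g' i t / 2) ((hg' i z hz).neg.div_const 2) j
  have hzero (j : Fin 3) : partialDeriv j (fun _ : Fin 3 → ℝ => (0 : ℝ)) z = 0 := by
    simp [partialDeriv]
  refine ⟨?_, fun i hi => ?_⟩
  · have := hR 0 0 1 1
    simp [hzero] at this
    field_simp at this
    simpa using this
  · have := hR i i 2 2
    fin_cases i
    · simp [hc, hzero] at this
      field_simp at this
      simp
      linarith
    · simp [hc, hzero] at this
      field_simp at this
      simp
      linarith
    · exact absurd rfl hi

end Metric

section Gquad

variable {A B : Fin 3 → ℝ} {t : ℝ}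

theorem Gquad_apply (A B : Fin 3 → ℝ) (t : ℝ) (i j : Fin 3) :
    Gquad A B t i j = if i = j then 1 + A i * t + B i * t ^ 2 else 0 := by
  by_cases hij : i = j
  · subst hij
    simp [Gquad]
    ring
  · simp [Gquad, hij]

theorem Gquad_apply_pos (hG : (Gquad A B t).PosDef) (i : Fin 3) :
    0 < 1 + A i * t + B i * t ^ 2 := by
  simpa [Gquad_apply] using hG.diag_pos (i := i)

end Gquad

open Polynomial in
/-- A quartic polynomial vanishing on a nontrivial interval has zero coefficients. -/
theorem quartic_coeff_eq_zero {a b : ℝ} (hab : a < b) {c₀ c₁ c₂ c₃ c₄ : ℝ}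
    (hc : ∀ t ∈ Set.Ioo a b, c₀ + c₁ * t + c₂ * t ^ 2 + c₃ * t ^ 3 + c₄ * t ^ 4 = 0) :
    c₀ = 0 ∧ c₁ = 0 ∧ c₂ = 0 ∧ c₃ = 0 ∧ c₄ = 0 := by
  have hp : C c₀ + C c₁ * X + C c₂ * X ^ 2 + C c₃ * X ^ 3 + C c₄ * X ^ 4 = 0 :=
    eq_zero_of_infinite_isRoot _ <| (Set.Ioo_infinite hab).mono fun t ht => by
      simpa using hc t ht
  have hcoeff (n : ℕ) := congrArg (fun p : ℝ[X] => p.coeff n) hp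
  have h0 := hcoeff 0
  have h1 := hcoeff 1
  have h2 := hcoeff 2
  have h3 := hcoeff 3
  have h4 := hcoeff 4
  simp [coeff_X, coeff_C, coeff_X_pow] at h0 h1 h2 h3 h4
  exact ⟨h0, h1, h2, h3, h4⟩

/-- Solutions of the curvature equation among quadratic metric coefficients
`1 + a t + b t²`, `1 + c t + d t²`. -/
theorem quadratic_coeffs_of_curvature {l r : ℝ} (hlr : l < r) {a b c d : ℝ}
    (hc : ∀ t ∈ Set.Ioo l r, 2 * (2 * b) * (1 + a * t + b * t ^ 2) * (1 + c * t + d * t ^ 2) =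
      (a + 2 * b * t) * (c + 2 * d * t) * (1 + a * t + b * t ^ 2) +
        (a + 2 * b * t) ^ 2 * (1 + c * t + d * t ^ 2)) :
    (a = 0 ∧ b = 0) ∨ (c = 0 ∧ d = 0 ∧ b = a ^ 2 / 4 ∧ b ≠ 0) := by
  obtain ⟨h0, h1, h2, h3, h4⟩ := quartic_coeff_eq_zero hlr
    (c₀ := 4 * b - a * c - a ^ 2)
    (c₁ := 2 * b * c - 2 * a * d - 2 * a ^ 2 * c)
    (c₂ := -3 * a * b * c - 3 * a ^ 2 * d)
    (c₃ := -2 * b ^ 2 * c - 6 * a * b * d)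
    (c₄ := -4 * b ^ 2 * d) fun t ht => by linear_combination hc t ht
  by_cases hb : b = 0
  · subst hb
    left
    by_contra! ha
    have ha : a ≠ 0 := fun h => ha h rfl
    have hd : d = 0 := by simpa [ha] using h2
    subst hd
    have hc0 : c = 0 := by simpa [ha] using h1
    subst hc0
    simp [ha] at h0
  · right
    have hd : d = 0 := by simpa [hb] using h4
    subst hd
    have hc0 : c = 0 := by simpa [hb] using h3
    subst hc0
    exact ⟨rfl, rfl, by linarith, hb⟩

theorem isOpen_slab {ω : Set (ℝ × ℝ)} (hω : IsOpen ω) (h : ℝ) : IsOpen (slab ω h) :=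
  (hω.preimage ((continuous_apply 0).prodMk (continuous_apply 1))).inter
    (isOpen_Ioo.preimage (continuous_apply 2))

theorem quadratic_coeffs_of_isometric {ω : Set (ℝ × ℝ)} (hω : IsOpen ω) (hne : ω.Nonempty)
    {h : ℝ} (hh : 0 < h) {A B : Fin 3 → ℝ}
    (hpos : ∀ t ∈ Set.Ioo (-(h / 2)) (h / 2), (Gquad A B t).PosDef)
    {v : (Fin 3 → ℝ) → Fin 3 → ℝ} (hv : ContDiffOn ℝ (⊤ : ℕ∞) v (slab ω h))
    (hmet : ∀ z ∈ slab ω h, (Dmat v z)ᵀ * Dmat v z = Gquad A B (z 2)) :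
    ((A 0 = 0 ∧ B 0 = 0) ∨ (A 1 = 0 ∧ B 1 = 0)) ∧
    ∀ i : Fin 3, i ≠ 2 →
      (A i = 0 ∧ B i = 0) ∨ (A 2 = 0 ∧ B 2 = 0 ∧ B i = A i ^ 2 / 4 ∧ B i ≠ 0) := by
  obtain ⟨p, hp⟩ := hne
  have hlr : -(h / 2) < h / 2 := by linarith
  have hcurv (t : ℝ) (ht : t ∈ Set.Ioo (-(h / 2)) (h / 2)) :=
    curvature_eq_zero (isOpen_slab hω h) hv (g := fun i t => 1 + A i * t + B i * t ^ 2)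
      (g' := fun i t => A i + 2 * B i * t) (g'' := fun i _ => 2 * B i)
      (fun z hz i j => by
        rw [← Gquad_apply, ← hmet z hz]
        rfl)
      (fun i z _ => by
        convert! (((hasDerivAt_id (z 2)).const_mul (A i)).const_add 1).add
          ((hasDerivAt_pow 2 (z 2)).const_mul (B i)) using 1
        simp
        ring)
      (fun i z _ => by
        simpa using ((hasDerivAt_id (z 2)).const_mul (2 * B i)).const_add (A i))
      (fun i z hz => Gquad_apply_pos (hpos _ hz.2) i)
      (z := ![p.1, p.2, t]) ⟨hp, ht⟩
  refine ⟨?_, fun i hi => quadratic_coeffs_of_curvature hlr fun t ht => (hcurv t ht).2 i hi⟩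
  obtain ⟨h0, h1, h2, -, -⟩ := quartic_coeff_eq_zero hlr
    (c₀ := A 0 * A 1) (c₁ := 2 * (A 0 * B 1 + B 0 * A 1)) (c₂ := 4 * (B 0 * B 1))
    (c₃ := 0) (c₄ := 0) fun t ht => by
      have h := (hcurv t ht).1
      simp only [cons_val] at h
      linear_combination h
  grind

section Realization

variable {v : (Fin 3 → ℝ) → Fin 3 → ℝ} {z : Fin 3 → ℝ}

theorem Dmat_eq_of_hasFDerivAt {L : Fin 3 → (Fin 3 → ℝ) →L[ℝ] ℝ}
    (hL : ∀ i, HasFDerivAt (fun z => v z i) (L i) z) :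
    Dmat v z = Matrix.of fun i j => L i (Pi.single j 1) := by
  have : HasFDerivAt v (ContinuousLinearMap.pi L) z := hasFDerivAt_pi.2 hL
  rw [Dmat, this.fderiv]
  rfl

/-- A primitive of `√g`, for `g` smooth and positive on an interval. -/
theorem exists_hasDerivAt_sqrt {l r : ℝ} {g : ℝ → ℝ} (hg : ContDiff ℝ (⊤ : ℕ∞) g)
    (hpos : ∀ t ∈ Set.Ioo l r, 0 < g t) :
    ∃ φ : ℝ → ℝ, ContDiffOn ℝ (⊤ : ℕ∞) φ (Set.Ioo l r) ∧ ∀ t, HasDerivAt φ √(g t) t := by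
  have hd (t : ℝ) : HasDerivAt (fun u => ∫ x in (0 : ℝ)..u, √(g x)) √(g t) t :=
    intervalIntegral.integral_hasDerivAt_right
      (hg.continuous.sqrt.intervalIntegrable _ _)
      hg.continuous.sqrt.aestronglyMeasurable.stronglyMeasurableAtFilter
      hg.continuous.sqrt.continuousAt
  refine ⟨_, (contDiffOn_infty_iff_deriv_of_isOpen isOpen_Ioo).2
    ⟨fun t _ => (hd t).differentiableAt.differentiableWithinAt, ?_⟩, hd⟩
  rw [funext fun t => (hd t).deriv]
  exact hg.contDiffOn.sqrt fun t ht => (hpos t ht).ne'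

theorem one_add_half_mul_pos {h a : ℝ}
    (hpos : ∀ t ∈ Set.Ioo (-(h / 2)) (h / 2), 0 < 1 + a * t + a ^ 2 / 4 * t ^ 2) {t : ℝ}
    (ht : t ∈ Set.Ioo (-(h / 2)) (h / 2)) : 0 < 1 + a / 2 * t := by
  by_contra! hneg
  have hlt : 0 < -(a / 2 * t) := by linarith
  set c := (-(a / 2 * t))⁻¹
  have hc0 : 0 < c := inv_pos.2 hlt
  have hc1 : c ≤ 1 := inv_le_one_of_one_le₀ (by linarith)
  have hroot : 1 + a / 2 * (c * t) = 0 := by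
    have : c * (-(a / 2 * t)) = 1 := inv_mul_cancel₀ hlt.ne'
    linarith
  have hmem : c * t ∈ Set.Ioo (-(h / 2)) (h / 2) := by
    rw [Set.mem_Ioo, ← abs_lt] at ht ⊢
    rw [abs_mul, abs_of_pos hc0]
    nlinarith [abs_nonneg t]
  have h1 := hpos _ hmem
  have h2 : 1 + a * (c * t) + a ^ 2 / 4 * (c * t) ^ 2 = (1 + a / 2 * (c * t)) ^ 2 := by ring
  rw [h2, hroot] at h1
  simp at h1

variable {ω : Set (ℝ × ℝ)} {h : ℝ} {A B : Fin 3 → ℝ}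

/-- Realization of `diag(1, 1, g(z₃))` by a reparametrization of the third coordinate. -/
theorem exists_realization_stretch
    (hpos : ∀ t ∈ Set.Ioo (-(h / 2)) (h / 2), (Gquad A B t).PosDef)
    (hA0 : A 0 = 0) (hA1 : A 1 = 0) (hB0 : B 0 = 0) (hB1 : B 1 = 0) :
    ∃ v : (Fin 3 → ℝ) → (Fin 3 → ℝ),
      ContDiffOn ℝ (⊤ : ℕ∞) v (slab ω h) ∧
      ∀ z ∈ slab ω h,
        0 < (Dmat v z).det ∧ (Dmat v z)ᵀ * Dmat v z = Gquad A B (z 2) := by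
  have hg (t : ℝ) (ht : t ∈ Set.Ioo (-(h / 2)) (h / 2)) := Gquad_apply_pos (hpos t ht) 2
  obtain ⟨φ, hφ, hφ'⟩ := exists_hasDerivAt_sqrt (g := fun t => 1 + A 2 * t + B 2 * t ^ 2)
    (by fun_prop) hg
  refine ⟨fun z => ![z 0, z 1, φ (z 2)], ?_, fun z hz => ?_⟩
  · refine contDiffOn_pi.2 fun i => ?_
    fin_cases i
    · exact (contDiff_apply ℝ ℝ 0).contDiffOn
    · exact (contDiff_apply ℝ ℝ 1).contDiffOn
    · exact hφ.comp (contDiff_apply ℝ ℝ 2).contDiffOn fun z hz => hz.2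
  · have hgz := hg (z 2) hz.2
    have hproj (i : Fin 3) := hasFDerivAt_apply (𝕜 := ℝ) i z
    rw [Dmat_eq_of_hasFDerivAt (L := ![.proj 0, .proj 1,
      √(1 + A 2 * z 2 + B 2 * z 2 ^ 2) • .proj 2])]
    · refine ⟨?_, ?_⟩
      · simpa [det_fin_three] using hgz
      · ext i j
        rw [Gquad_apply]
        fin_cases i <;> fin_cases j <;>
          simp [Matrix.mul_apply, Fin.sum_univ_three, *, Real.mul_self_sqrt hgz.le]
    · intro i
      fin_cases i
      · exact hproj 0
      · exact hproj 1
      · exact (hφ' (z 2)).comp_hasFDerivAt z (hproj 2)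

/-- Realization of `diag((1 + a z₃ / 2)², 1, 1)` by polar coordinates. -/
theorem exists_realization_polar_fst
    (hpos : ∀ t ∈ Set.Ioo (-(h / 2)) (h / 2), (Gquad A B t).PosDef)
    (hA1 : A 1 = 0) (hA2 : A 2 = 0) (hB1 : B 1 = 0) (hB2 : B 2 = 0)
    (hB0 : B 0 = A 0 ^ 2 / 4) (hB0' : B 0 ≠ 0) :
    ∃ v : (Fin 3 → ℝ) → (Fin 3 → ℝ),
      ContDiffOn ℝ (⊤ : ℕ∞) v (slab ω h) ∧
      ∀ z ∈ slab ω h,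
        0 < (Dmat v z).det ∧ (Dmat v z)ᵀ * Dmat v z = Gquad A B (z 2) := by
  have ha : A 0 ≠ 0 := fun h => hB0' (by simp [hB0, h])
  refine ⟨fun z => ![(z 2 + 2 / A 0) * sin (A 0 / 2 * z 0), z 1,
    (z 2 + 2 / A 0) * cos (A 0 / 2 * z 0)], ?_, fun z hz => ?_⟩
  · refine contDiffOn_pi.2 fun i => ContDiff.contDiffOn ?_
    fin_cases i <;> simp <;> fun_prop
  · have hr : 0 < 1 + A 0 / 2 * z 2 := one_add_half_mul_pos
      (fun t ht => by simpa [hB0] using Gquad_apply_pos (hpos t ht) 0) hz.2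
    have hproj (i : Fin 3) := hasFDerivAt_apply (𝕜 := ℝ) i z
    have htrig := sin_sq_add_cos_sq (A 0 / 2 * z 0)
    rw [Dmat_eq_of_hasFDerivAt (L := ![_, _, _])]
    rotate_left
    · intro i
      fin_cases i
      · exact ((hproj 2).add_const (2 / A 0)).mul ((hproj 0).const_mul (A 0 / 2)).sin
      · exact hproj 1
      · exact ((hproj 2).add_const (2 / A 0)).mul ((hproj 0).const_mul (A 0 / 2)).cos
    · refine ⟨?_, ?_⟩
      · convert hr using 1
        simp [det_fin_three]
        generalize A 0 / 2 * z 0 = θ at htrig ⊢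
        field_simp
        linear_combination (A 0 * z 2 + 2) * htrig
      · ext i j
        rw [Gquad_apply]
        fin_cases i <;> fin_cases j <;>
          simp [Matrix.mul_apply, Fin.sum_univ_three, *]
        · generalize A 0 / 2 * z 0 = θ at htrig ⊢
          field_simp
          linear_combination 4 * (A 0 * z 2 + 2) ^ 2 * htrig
        · ring
        · ring
        · linear_combination htrig

/-- Realization of `diag(1, (1 + a z₃ / 2)², 1)` by polar coordinates. -/
theorem exists_realization_polar_snd
    (hpos : ∀ t ∈ Set.Ioo (-(h / 2)) (h / 2), (Gquad A B t).PosDef)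
    (hA0 : A 0 = 0) (hA2 : A 2 = 0) (hB0 : B 0 = 0) (hB2 : B 2 = 0)
    (hB1 : B 1 = A 1 ^ 2 / 4) (hB1' : B 1 ≠ 0) :
    ∃ v : (Fin 3 → ℝ) → (Fin 3 → ℝ),
      ContDiffOn ℝ (⊤ : ℕ∞) v (slab ω h) ∧
      ∀ z ∈ slab ω h,
        0 < (Dmat v z).det ∧ (Dmat v z)ᵀ * Dmat v z = Gquad A B (z 2) := by
  have ha : A 1 ≠ 0 := fun h => hB1' (by simp [hB1, h])
  refine ⟨fun z => ![z 0, (z 2 + 2 / A 1) * sin (A 1 / 2 * z 1),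
    (z 2 + 2 / A 1) * cos (A 1 / 2 * z 1)], ?_, fun z hz => ?_⟩
  · refine contDiffOn_pi.2 fun i => ContDiff.contDiffOn ?_
    fin_cases i <;> simp <;> fun_prop
  · have hr : 0 < 1 + A 1 / 2 * z 2 := one_add_half_mul_pos
      (fun t ht => by simpa [hB1] using Gquad_apply_pos (hpos t ht) 1) hz.2
    have hproj (i : Fin 3) := hasFDerivAt_apply (𝕜 := ℝ) i z
    have htrig := sin_sq_add_cos_sq (A 1 / 2 * z 1)
    rw [Dmat_eq_of_hasFDerivAt (L := ![_, _, _])]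
    rotate_left
    · intro i
      fin_cases i
      · exact hproj 0
      · exact ((hproj 2).add_const (2 / A 1)).mul ((hproj 1).const_mul (A 1 / 2)).sin
      · exact ((hproj 2).add_const (2 / A 1)).mul ((hproj 1).const_mul (A 1 / 2)).cos
    · refine ⟨?_, ?_⟩
      · convert hr using 1
        simp [det_fin_three]
        generalize A 1 / 2 * z 1 = θ at htrig ⊢
        field_simp
        linear_combination (A 1 * z 2 + 2) * htrig
      · ext i j
        rw [Gquad_apply]
        fin_cases i <;> fin_cases j <;>
          simp [Matrix.mul_apply, Fin.sum_univ_three, *]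
        · generalize A 1 / 2 * z 1 = θ at htrig ⊢
          field_simp
          linear_combination 4 * (A 1 * z 2 + 2) ^ 2 * htrig
        · ring
        · ring
        · linear_combination htrig

end Realization

/-- for diagonal `A = diag(A₁,A₂,A₃)`, `B = diag(B₁,B₂,B₃)` with
`G(t) = I₃ + t A + t² B` positive definite on `(−h/2, h/2)`, the strain `G(z₃)` is
kinematically compatible on `Ω_h = ω × (−h/2, h/2)` iff one of the four conditions
(i)–(iv) holds. -/
theorem stmt12 (ω : Set (ℝ × ℝ)) (hω : IsOpen ω) (hne : ω.Nonempty)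
    (hb : Bornology.IsBounded ω) (hc : Convex ℝ ω)
    (h : ℝ) (hh : 0 < h) (A B : Fin 3 → ℝ)
    (hpos : ∀ t ∈ Set.Ioo (-(h / 2)) (h / 2), (Gquad A B t).PosDef) :
    (∃ v : (Fin 3 → ℝ) → (Fin 3 → ℝ),
      ContDiffOn ℝ (⊤ : ℕ∞) v (slab ω h) ∧
      ∀ z ∈ slab ω h,
        0 < (Dmat v z).det ∧ (Dmat v z)ᵀ * Dmat v z = Gquad A B (z 2)) ↔
    ((A = 0 ∧ B = 0) ∨
     (A 1 = 0 ∧ A 2 = 0 ∧ B 1 = 0 ∧ B 2 = 0 ∧ B 0 = (A 0) ^ 2 / 4 ∧ B 0 ≠ 0) ∨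
     (A 0 = 0 ∧ A 2 = 0 ∧ B 0 = 0 ∧ B 2 = 0 ∧ B 1 = (A 1) ^ 2 / 4 ∧ B 1 ≠ 0) ∨
     (A 0 = 0 ∧ A 1 = 0 ∧ B 0 = 0 ∧ B 1 = 0 ∧ (A 2) ^ 2 + (B 2) ^ 2 ≠ 0)) := by
  constructor
  · rintro ⟨v, hv, hv'⟩
    obtain ⟨h01, hi⟩ := quadratic_coeffs_of_isometric hω hne hh hpos hv fun z hz => (hv' z hz).2
    rcases hi 0 (by decide) with ⟨hA0, hB0⟩ | ⟨hA2, hB2, hB0, hB0'⟩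
    · rcases hi 1 (by decide) with ⟨hA1, hB1⟩ | ⟨hA2, hB2, hB1, hB1'⟩
      · by_cases h2 : A 2 ^ 2 + B 2 ^ 2 = 0
        · have hA2 : A 2 = 0 := by nlinarith [sq_nonneg (A 2), sq_nonneg (B 2)]
          have hB2 : B 2 = 0 := by nlinarith [sq_nonneg (A 2), sq_nonneg (B 2)]
          left
          constructor <;> ext i <;> fin_cases i <;> assumption
        · exact Or.inr (Or.inr (Or.inr ⟨hA0, hA1, hB0, hB1, h2⟩))
      · exact Or.inr (Or.inr (Or.inl ⟨hA0, hA2, hB0, hB2, hB1, hB1'⟩))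
    · obtain ⟨hA1, hB1⟩ := h01.resolve_left fun h => hB0' h.2
      exact Or.inr (Or.inl ⟨hA1, hA2, hB1, hB2, hB0, hB0'⟩)
  · rintro (⟨rfl, rfl⟩ | ⟨h1, h2, h3, h4, h5, h6⟩ | ⟨h1, h2, h3, h4, h5, h6⟩ |
      ⟨h1, h2, h3, h4, -⟩)
    · exact exists_realization_stretch hpos rfl rfl rfl rfl
    · exact exists_realization_polar_fst hpos h1 h2 h3 h4 h5 h6
    · exact exists_realization_polar_snd hpos h1 h2 h3 h4 h5 h6
    · exact exists_realization_stretch hpos h1 h2 h3 h4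
end
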